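/- Let n ≥ 4 and 1 ≤ k ≤ n−3, and let Λ = ℤv₁ + ⋯ + ℤv_k be the rank-k lattice spanned by ℝ-linearly independent vectors v₁, …, v_k ∈ ℝⁿ. Then for every x ∈ ℝⁿ∖Λ the family (|x+ω|^{2−n})_{ω∈Λ} is summable, the function H_Λ(x) = Σ_{ω∈Λ} |x+ω|^{2−n} satisfies H_Λ(x+v) = H_Λ(x) for all v ∈ Λ, and H_Λ is harmonic on ℝⁿ∖Λ, i.e. it is twice continuously differentiable there with Σ_{j=1}^n ∂²H_Λ/∂x_j² = 0. -/

import Mathlib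

noncomputable section

abbrev Euc (n : ℕ) := EuclideanSpace ℝ (Fin n)

/-- The lattice point `m₁v₁ + ⋯ + m_kv_k` associated to integer coefficients `m`. -/
def latt {n k : ℕ} (v : Fin k → Euc n) (m : Fin k → ℤ) : Euc n :=
  ∑ i, (m i : ℝ) • v i

/-- The lattice `Λ = ℤv₁ + ⋯ + ℤv_k` spanned by the vectors `v i`. -/
def lattice {n k : ℕ} (v : Fin k → Euc n) : Set (Euc n) := Set.range (latt v)

open scoped Topology

section NormRpow

variable {E : Type*} [NormedAddCommGroup E] [InnerProductSpace ℝ E]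

/-- The real inner product as a continuous bilinear map. -/
def realInnerCLM : E →L[ℝ] E →L[ℝ] ℝ := innerSL ℝ

@[simp] lemma realInnerCLM_apply (y w : E) : realInnerCLM y w = inner ℝ y w := rfl

lemma norm_realInnerCLM_apply (y : E) : ‖realInnerCLM y‖ = ‖y‖ := innerSL_apply_norm ℝ y

lemma norm_realInnerCLM_le : ‖(realInnerCLM : E →L[ℝ] E →L[ℝ] ℝ)‖ ≤ 1 :=
  ContinuousLinearMap.opNorm_le_bound _ zero_le_one fun z => by
    rw [one_mul, norm_realInnerCLM_apply]

/-- The derivative of `y ↦ ‖y‖ ^ p` away from the origin. -/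
def normRpowFDeriv (p : ℝ) (y : E) : E →L[ℝ] ℝ :=
  (p * ‖y‖ ^ (p - 2)) • realInnerCLM y

/-- The second derivative of `y ↦ ‖y‖ ^ p` away from the origin. -/
def normRpowFDeriv₂ (p : ℝ) (y : E) : E →L[ℝ] E →L[ℝ] ℝ :=
  (p * ‖y‖ ^ (p - 2)) • (realInnerCLM : E →L[ℝ] E →L[ℝ] ℝ) +
    (p • normRpowFDeriv (p - 2) y).smulRight (realInnerCLM y)

lemma hasFDerivAt_norm_rpow_of_ne_zero (p : ℝ) {y : E} (hy : y ≠ 0) :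
    HasFDerivAt (fun z : E => ‖z‖ ^ p) (normRpowFDeriv p y) y := by
  have hy' : 0 < ‖y‖ := norm_pos_iff.2 hy
  have h := ((hasStrictFDerivAt_norm_sq y).rpow_const (p := p / 2) (by simp [hy])).hasFDerivAt
  refine (h.congr_fderiv ?_).congr_of_eventuallyEq ?_
  · ext w
    have : (‖y‖ ^ 2) ^ (p / 2 - 1) = ‖y‖ ^ (p - 2) := by
      rw [← Real.rpow_natCast, ← Real.rpow_mul hy'.le]
      congr 1
      push_cast
      ring
    simp [normRpowFDeriv, this]
    ring
  · filter_upwards with z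
    rw [← Real.rpow_natCast, ← Real.rpow_mul (norm_nonneg z)]
    congr 1
    push_cast
    ring

lemma hasFDerivAt_normRpowFDeriv (p : ℝ) {y : E} (hy : y ≠ 0) :
    HasFDerivAt (fun z : E => normRpowFDeriv p z) (normRpowFDeriv₂ p y) y :=
  ((hasFDerivAt_norm_rpow_of_ne_zero (p - 2) hy).const_mul p).smul
    (realInnerCLM : E →L[ℝ] E →L[ℝ] ℝ).hasFDerivAt

lemma continuousAt_normRpowFDeriv₂ (p : ℝ) {y : E} (hy : y ≠ 0) :
    ContinuousAt (fun z : E => normRpowFDeriv₂ p z) y := by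
  have h₁ := (hasFDerivAt_norm_rpow_of_ne_zero (p - 2) hy).continuousAt
  have h₂ := (hasFDerivAt_normRpowFDeriv (p - 2) hy).continuousAt
  have h₃ := (realInnerCLM : E →L[ℝ] E →L[ℝ] ℝ).continuous.continuousAt (x := y)
  have h₄ := (ContinuousLinearMap.smulRightL ℝ E (E →L[ℝ] ℝ)).continuous₂.continuousAt.comp
    ((h₂.const_smul p).prodMk h₃)
  exact ((h₁.const_mul p).smul continuousAt_const).add h₄

lemma norm_normRpowFDeriv_le (p : ℝ) {y : E} (hy : y ≠ 0) :
    ‖normRpowFDeriv p y‖ ≤ |p| * ‖y‖ ^ (p - 1) := by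
  have hy' : 0 < ‖y‖ := norm_pos_iff.2 hy
  rw [normRpowFDeriv, norm_smul, norm_realInnerCLM_apply, norm_mul, Real.norm_eq_abs, Real.norm_eq_abs,
    abs_of_nonneg (Real.rpow_nonneg hy'.le _), mul_assoc, ← Real.rpow_add_one hy'.ne',
    show p - 2 + 1 = p - 1 by ring]

lemma norm_normRpowFDeriv₂_le (p : ℝ) {y : E} (hy : y ≠ 0) :
    ‖normRpowFDeriv₂ p y‖ ≤ (|p| + |p| * |p - 2|) * ‖y‖ ^ (p - 2) := by
  have hy' : 0 < ‖y‖ := norm_pos_iff.2 hy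
  have h₂ : ‖normRpowFDeriv (p - 2) y‖ * ‖y‖ ≤ |p - 2| * ‖y‖ ^ (p - 2) := by
    have := norm_normRpowFDeriv_le (p - 2) hy
    calc ‖normRpowFDeriv (p - 2) y‖ * ‖y‖ ≤ |p - 2| * ‖y‖ ^ (p - 2 - 1) * ‖y‖ := by gcongr
      _ = _ := by
        rw [mul_assoc, ← Real.rpow_add_one hy'.ne', sub_add_cancel]
  calc ‖normRpowFDeriv₂ p y‖ ≤ |p| * ‖y‖ ^ (p - 2) * 1 + |p| * (‖normRpowFDeriv (p - 2) y‖ * ‖y‖) := by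
        rw [normRpowFDeriv₂]
        refine (norm_add_le (E := E →L[ℝ] E →L[ℝ] ℝ) _ _).trans (add_le_add ?_ (le_of_eq ?_))
        · refine (ContinuousLinearMap.opNorm_smul_le _ _).trans ?_
          rw [norm_mul, Real.norm_eq_abs, Real.norm_eq_abs,
            abs_of_nonneg (Real.rpow_nonneg hy'.le _)]
          gcongr
          exact norm_realInnerCLM_le
        · rw [ContinuousLinearMap.norm_smulRight_apply, norm_smul, norm_realInnerCLM_apply,
            Real.norm_eq_abs, mul_assoc]
    _ ≤ |p| * ‖y‖ ^ (p - 2) * 1 + |p| * (|p - 2| * ‖y‖ ^ (p - 2)) := by gcongr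
    _ = _ := by ring

lemma sum_normRpowFDeriv₂_orthonormalBasis {ι : Type*} [Fintype ι] (b : OrthonormalBasis ι ℝ E)
    (p : ℝ) {y : E} (hy : y ≠ 0) :
    ∑ j, normRpowFDeriv₂ p y (b j) (b j) = p * (Fintype.card ι + p - 2) * ‖y‖ ^ (p - 2) := by
  have hy' : 0 < ‖y‖ := norm_pos_iff.2 hy
  have h (j : ι) : normRpowFDeriv₂ p y (b j) (b j) =
      p * ‖y‖ ^ (p - 2) + p * (p - 2) * ‖y‖ ^ (p - 2 - 2) * inner ℝ y (b j) ^ 2 := by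
    simp [normRpowFDeriv₂, normRpowFDeriv]
    ring
  have hs : ∑ j, inner ℝ y (b j) ^ 2 = ‖y‖ ^ 2 := by
    simp [← b.sum_sq_norm_inner_left y]
  have hm : ‖y‖ ^ (p - 2 - 2) * ‖y‖ ^ 2 = ‖y‖ ^ (p - 2) := by
    rw [← Real.rpow_add_natCast hy'.ne', Nat.cast_ofNat, sub_add_cancel]
  simp_rw [h]
  rw [Finset.sum_add_distrib, Finset.sum_const, ← Finset.mul_sum, hs, mul_assoc (p * (p - 2)), hm]
  simp
  ring

end NormRpow

section SecondOrder

variable {E : Type*} [NormedAddCommGroup E] [NormedSpace ℝ E]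
  {F : Type*} [NormedAddCommGroup F] [NormedSpace ℝ F]

lemma contDiffOn_two_of_hasFDerivAt {s : Set E} (hs : IsOpen s) {f : E → F}
    {f' : E → E →L[ℝ] F} {f'' : E → E →L[ℝ] E →L[ℝ] F}
    (hf : ∀ x ∈ s, HasFDerivAt f (f' x) x) (hf' : ∀ x ∈ s, HasFDerivAt f' (f'' x) x)
    (hf'' : ContinuousOn f'' s) : ContDiffOn ℝ 2 f s := by
  rw [show (2 : WithTop ℕ∞) = 1 + 1 from one_add_one_eq_two.symm,
    contDiffOn_succ_iff_hasFDerivWithinAt_of_uniqueDiffOn hs.uniqueDiffOn]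
  refine ⟨by simp, f', ?_, fun x hx => (hf x hx).hasFDerivWithinAt⟩
  rw [← zero_add (1 : WithTop ℕ∞),
    contDiffOn_succ_iff_hasFDerivWithinAt_of_uniqueDiffOn hs.uniqueDiffOn]
  exact ⟨by simp, f'', contDiffOn_zero.2 hf'', fun x hx => (hf' x hx).hasFDerivWithinAt⟩

lemma fderiv_fderiv_apply_of_hasFDerivAt {f : E → F}
    {f' : E → E →L[ℝ] F} {f'' : E →L[ℝ] E →L[ℝ] F} {x : E}
    (hf : ∀ᶠ y in 𝓝 x, HasFDerivAt f (f' y) y) (hf' : HasFDerivAt f' f'' x) (v w : E) :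
    fderiv ℝ (fun y => fderiv ℝ f y v) x w = f'' w v := by
  have h : (fun y => fderiv ℝ f y v) =ᶠ[𝓝 x] fun y => f' y v := by
    filter_upwards [hf] with y hy
    rw [hy.fderiv]
  rw [h.fderiv_eq, (hf'.clm_apply (hasFDerivAt_const v x)).fderiv]
  simp

lemma HasSum.clm_apply_const {ι : Type*} {f : ι → E →L[ℝ] F} {a : E →L[ℝ] F} (h : HasSum f a)
    (v : E) : HasSum (fun i => f i v) (a v) :=
  (ContinuousLinearMap.apply ℝ F v).hasSum h

end SecondOrder

section LatticeSum

variable {E : Type*} [NormedAddCommGroup E]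

lemma isClosed_of_discrete_submodule (L : Submodule ℤ E) [DiscreteTopology L] :
    IsClosed (L : Set E) :=
  @AddSubgroup.isClosed_of_discrete _ _ _ _ _ L.toAddSubgroup
    (inferInstanceAs (DiscreteTopology L))

lemma add_ne_zero_of_notMem {L : Submodule ℤ E} {x : E} (hx : x ∉ L) (ω : L) : x + ω ≠ 0 :=
  fun h => hx (by rw [eq_neg_of_add_eq_zero_left h]; exact L.neg_mem ω.2)

variable {L : Submodule ℤ E} [DiscreteTopology L]

/-- Near a point off the lattice, all distances to lattice points are comparable. -/
lemma exists_ball_norm_add_le {x : E} (hx : x ∉ L) :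
    ∃ δ > 0, ∀ y ∈ Metric.ball x δ, ∀ ω : L, y + ω ≠ 0 ∧ ‖x + (ω : E)‖ ≤ 2 * ‖y + (ω : E)‖ := by
  obtain ⟨ε, hε, h⟩ := Metric.isOpen_iff.1 (isClosed_of_discrete_submodule L).isOpen_compl x hx
  refine ⟨ε / 2, half_pos hε, fun y hy ω => ?_⟩
  have h₁ : ε ≤ ‖x + (ω : E)‖ := by
    by_contra! hlt
    have hm : -(ω : E) ∈ Metric.ball x ε := by
      rwa [Metric.mem_ball, dist_comm, dist_eq_norm, sub_neg_eq_add]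
    exact h hm (L.neg_mem ω.2)
  have h₂ : ‖x + (ω : E)‖ ≤ ‖y + (ω : E)‖ + ‖x - y‖ := by
    rw [show x + (ω : E) = (y + ω) + (x - y) by abel]
    exact norm_add_le _ _
  have h₃ : ‖x - y‖ < ε / 2 := by
    rwa [Metric.mem_ball, dist_comm, dist_eq_norm] at hy
  refine ⟨norm_pos_iff.1 (by linarith), by linarith⟩

variable [InnerProductSpace ℝ E] [FiniteDimensional ℝ E]

lemma summable_norm_add_rpow {r : ℝ} (hr : r < -Module.finrank ℤ L) (x : E) :
    Summable fun ω : L => ‖x + (ω : E)‖ ^ r := by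
  simpa [add_comm] using ZLattice.summable_norm_sub_rpow L r hr (-x)

/-- A locally uniform summable majorant for lattice sums of functions of size `C * ‖y‖ ^ r`. -/
lemma exists_summable_bound {r : ℝ} (hr : r < -Module.finrank ℤ L) {F : Type*}
    [NormedAddCommGroup F] {g : E → F} {C : ℝ} (hC : 0 ≤ C)
    (hg : ∀ y, y ≠ 0 → ‖g y‖ ≤ C * ‖y‖ ^ r) {x : E} (hx : x ∉ L) :
    ∃ δ > 0, ∃ u : L → ℝ, Summable u ∧
      ∀ ω : L, ∀ y ∈ Metric.ball x δ, y + ω ≠ 0 ∧ ‖g (y + (ω : E))‖ ≤ u ω := by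
  obtain ⟨δ, hδ, h⟩ := exists_ball_norm_add_le hx
  have hr₀ : r ≤ 0 := hr.le.trans (by simp)
  refine ⟨δ, hδ, fun ω => C * ((1 / 2) ^ r * ‖x + (ω : E)‖ ^ r),
    ((summable_norm_add_rpow hr x).mul_left _).mul_left _, fun ω y hy => ?_⟩
  obtain ⟨h₀, h₁⟩ := h y hy ω
  refine ⟨h₀, (hg _ h₀).trans ?_⟩
  dsimp only
  rw [← Real.mul_rpow (by norm_num) (norm_nonneg _)]
  refine mul_le_mul_of_nonneg_left ?_ hC
  refine Real.rpow_le_rpow_of_nonpos ?_ (by linarith) hr₀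
  exact mul_pos (by norm_num) (norm_pos_iff.2 (add_ne_zero_of_notMem hx ω))

lemma hasFDerivAt_tsum_lattice {r : ℝ} (hr : r < -Module.finrank ℤ L) {F : Type*}
    [NormedAddCommGroup F] [NormedSpace ℝ F] [CompleteSpace F] {g : E → F} {g' : E → E →L[ℝ] F}
    {C : ℝ} (hC : 0 ≤ C) (hg : ∀ y, y ≠ 0 → HasFDerivAt g (g' y) y)
    (hg' : ∀ y, y ≠ 0 → ‖g' y‖ ≤ C * ‖y‖ ^ r) {x : E} (hx : x ∉ L)
    (hs : Summable fun ω : L => g (x + (ω : E))) :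
    HasFDerivAt (fun y => ∑' ω : L, g (y + (ω : E))) (∑' ω : L, g' (x + (ω : E))) x := by
  obtain ⟨δ, hδ, u, hu, h⟩ := exists_summable_bound hr hC hg' hx
  refine hasFDerivAt_tsum_of_isPreconnected (f := fun (ω : L) y => g (y + (ω : E)))
    (f' := fun (ω : L) y => g' (y + (ω : E))) hu Metric.isOpen_ball
    (convex_ball x δ).isPreconnected (fun ω y hy => ?_) (fun ω y hy => (h ω y hy).2)
    (Metric.mem_ball_self hδ) hs (Metric.mem_ball_self hδ)
  exact (hasFDerivAt_comp_add_right (ω : E)).2 (hg _ (h ω y hy).1)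

lemma continuousAt_tsum_lattice {r : ℝ} (hr : r < -Module.finrank ℤ L) {F : Type*}
    [NormedAddCommGroup F] [CompleteSpace F] {g : E → F} {C : ℝ} (hC : 0 ≤ C)
    (hg : ∀ y, y ≠ 0 → ContinuousAt g y) (hg' : ∀ y, y ≠ 0 → ‖g y‖ ≤ C * ‖y‖ ^ r)
    {x : E} (hx : x ∉ L) :
    ContinuousAt (fun y => ∑' ω : L, g (y + (ω : E))) x := by
  obtain ⟨δ, hδ, u, hu, h⟩ := exists_summable_bound hr hC hg' hx
  refine (continuousOn_tsum (f := fun (ω : L) y => g (y + (ω : E))) (fun ω y hy => ?_) hu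
    fun ω y hy => (h ω y hy).2).continuousAt (Metric.ball_mem_nhds x hδ)
  exact (ContinuousAt.comp (f := fun z : E => z + ω) (hg _ (h ω y hy).1)
    (by fun_prop)).continuousWithinAt

lemma summable_lattice_of_norm_le {r : ℝ} (hr : r < -Module.finrank ℤ L) {F : Type*}
    [NormedAddCommGroup F] [CompleteSpace F] {g : E → F} {C : ℝ}
    (hg : ∀ y, y ≠ 0 → ‖g y‖ ≤ C * ‖y‖ ^ r) {x : E} (hx : x ∉ L) :
    Summable fun ω : L => g (x + (ω : E)) :=
  .of_norm_bounded ((summable_norm_add_rpow hr x).mul_left C)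
    fun ω => hg _ (add_ne_zero_of_notMem hx ω)

lemma hasFDerivAt_tsum_norm_rpow {p : ℝ}
    (hp : p < -Module.finrank ℤ L) {x : E} (hx : x ∉ L) :
    HasFDerivAt (fun y => ∑' ω : L, ‖y + (ω : E)‖ ^ p) (∑' ω : L, normRpowFDeriv p (x + (ω : E))) x :=
  hasFDerivAt_tsum_lattice (r := p - 1) (by linarith) (abs_nonneg p)
    (fun _ => hasFDerivAt_norm_rpow_of_ne_zero p) (fun _ => norm_normRpowFDeriv_le p) hx
    (summable_norm_add_rpow hp x)

lemma hasFDerivAt_tsum_normRpowFDeriv {p : ℝ}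
    (hp : p < -Module.finrank ℤ L) {x : E} (hx : x ∉ L) :
    HasFDerivAt (fun y => ∑' ω : L, normRpowFDeriv p (y + (ω : E)))
      (∑' ω : L, normRpowFDeriv₂ p (x + (ω : E))) x :=
  hasFDerivAt_tsum_lattice (r := p - 2) (by linarith) (by positivity)
    (fun _ => hasFDerivAt_normRpowFDeriv p) (fun _ => norm_normRpowFDeriv₂_le p) hx
    (summable_lattice_of_norm_le (r := p - 1) (by linarith)
      (fun _ => norm_normRpowFDeriv_le p) hx)

lemma continuousAt_tsum_normRpowFDeriv₂ {p : ℝ}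
    (hp : p < -Module.finrank ℤ L) {x : E} (hx : x ∉ L) :
    ContinuousAt (fun y => ∑' ω : L, normRpowFDeriv₂ p (y + (ω : E))) x :=
  continuousAt_tsum_lattice (g := normRpowFDeriv₂ p) (C := |p| + |p| * |p - 2|) (r := p - 2)
    (by linarith) (by positivity)
    (fun _ => continuousAt_normRpowFDeriv₂ p) (fun _ => norm_normRpowFDeriv₂_le p) hx

lemma contDiffOn_tsum_norm_rpow {p : ℝ} (hp : p < -Module.finrank ℤ L) :
    ContDiffOn ℝ 2 (fun y => ∑' ω : L, ‖y + (ω : E)‖ ^ p) {x | x ∉ L} :=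
  contDiffOn_two_of_hasFDerivAt (isClosed_of_discrete_submodule L).isOpen_compl
    (f' := fun y => ∑' ω : L, normRpowFDeriv p (y + (ω : E)))
    (f'' := fun y => ∑' ω : L, normRpowFDeriv₂ p (y + (ω : E)))
    (fun _ hx => hasFDerivAt_tsum_norm_rpow hp hx)
    (fun _ hx => hasFDerivAt_tsum_normRpowFDeriv hp hx)
    fun _ hx => (continuousAt_tsum_normRpowFDeriv₂ hp hx).continuousWithinAt

lemma sum_fderiv_fderiv_tsum_norm_rpow {p : ℝ} (hp : p < -Module.finrank ℤ L) {ι : Type*}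
    [Fintype ι] (b : OrthonormalBasis ι ℝ E) {x : E} (hx : x ∉ L) :
    ∑ j, fderiv ℝ (fun y => fderiv ℝ (fun z => ∑' ω : L, ‖z + (ω : E)‖ ^ p) y (b j)) x (b j) =
      p * (Fintype.card ι + p - 2) * ∑' ω : L, ‖x + (ω : E)‖ ^ (p - 2) := by
  have hs : Summable fun ω : L => normRpowFDeriv₂ p (x + (ω : E)) :=
    summable_lattice_of_norm_le (g := normRpowFDeriv₂ p) (r := p - 2) (by linarith)
      (fun _ => norm_normRpowFDeriv₂_le p) hx
  have he : ∀ᶠ y in 𝓝 x, y ∉ L :=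
    (isClosed_of_discrete_submodule L).isOpen_compl.mem_nhds hx
  have h (j : ι) : HasSum (fun ω : L => normRpowFDeriv₂ p (x + (ω : E)) (b j) (b j))
      (fderiv ℝ (fun y => fderiv ℝ (fun z => ∑' ω : L, ‖z + (ω : E)‖ ^ p) y (b j)) x (b j)) := by
    rw [fderiv_fderiv_apply_of_hasFDerivAt
      (he.mono fun _ hy => hasFDerivAt_tsum_norm_rpow hp hy)
      (hasFDerivAt_tsum_normRpowFDeriv hp hx)]
    exact (hs.hasSum.clm_apply_const (b j)).clm_apply_const (b j)
  rw [← (hasSum_sum fun j _ => h j).tsum_eq, ← tsum_mul_left]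
  exact tsum_congr fun ω =>
    sum_normRpowFDeriv₂_orthonormalBasis b p (add_ne_zero_of_notMem hx ω)

end LatticeSum

section Span

variable {E ι : Type*} [NormedAddCommGroup E] [NormedSpace ℝ E] [FiniteDimensional ℝ E]
  {v : ι → E}

lemma LinearIndependent.discreteTopology_span_int (hv : LinearIndependent ℝ v) :
    DiscreteTopology (Submodule.span ℤ (Set.range v)) := by
  let b := Module.Basis.extend hv.linearIndepOn_id
  have : Finite (hv.linearIndepOn_id.extend (Set.subset_univ _)) := Module.Finite.finite_basis b
  have hle : Submodule.span ℤ (Set.range v) ≤ Submodule.span ℤ (Set.range b) := by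
    refine Submodule.span_mono ?_
    rw [Module.Basis.range_extend]
    exact hv.linearIndepOn_id.subset_extend _
  exact DiscreteTopology.of_continuous_injective (f := Submodule.inclusion hle)
    (continuous_inclusion hle) (Submodule.inclusion_injective hle)

end Span

lemma lattice_eq_span {n k : ℕ} (v : Fin k → Euc n) :
    lattice v = (Submodule.span ℤ (Set.range v) : Set (Euc n)) := by
  ext x
  simp [lattice, latt, Submodule.mem_span_range_iff_exists_fun, Int.cast_smul_eq_zsmul]

/-- For `n ≥ 4`, `1 ≤ k ≤ n-3` and a rank-`k` lattice `Λ`: for every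
`x ∈ ℝⁿ∖Λ` the family `(|x+ω|^{2-n})_{ω∈Λ}` is summable, the function
`H_Λ(x) = Σ_{ω∈Λ} |x+ω|^{2-n}` is `Λ`-periodic on `ℝⁿ∖Λ`, and `H_Λ` is harmonic on `ℝⁿ∖Λ`
(twice continuously differentiable with vanishing Laplacian). -/
theorem stmt11 (n k : ℕ) (hn : 4 ≤ n) (hk1 : 1 ≤ k) (hk2 : k ≤ n - 3)
    (v : Fin k → Euc n) (hv : LinearIndependent ℝ v)
    (H : Euc n → ℝ)
    (hH : ∀ x : Euc n, H x = ∑' ω : ↥(lattice v), ‖x + (ω : Euc n)‖ ^ (2 - (n : ℝ))) :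
    (∀ x : Euc n, x ∉ lattice v →
      Summable (fun ω : ↥(lattice v) => ‖x + (ω : Euc n)‖ ^ (2 - (n : ℝ)))) ∧
    (∀ w ∈ lattice v, ∀ x : Euc n, x ∉ lattice v → H (x + w) = H x) ∧
    ContDiffOn ℝ 2 H {x | x ∉ lattice v} ∧
    (∀ x : Euc n, x ∉ lattice v →
      ∑ j : Fin n,
        fderiv ℝ (fun y => fderiv ℝ H y (EuclideanSpace.single j 1)) x
          (EuclideanSpace.single j 1) = 0) := by
  have hd := hv.discreteTopology_span_int
  have hfin : Module.finrank ℤ (Submodule.span ℤ (Set.range v)) = k := by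
    rw [finrank_span_eq_card (hv.restrict_scalars' ℤ), Fintype.card_fin]
  rw [lattice_eq_span] at hH ⊢
  generalize Submodule.span ℤ (Set.range v) = L at *
  have hp : 2 - (n : ℝ) < -Module.finrank ℤ L := by
    have : (k : ℝ) + 3 ≤ n := by exact_mod_cast (by omega : k + 3 ≤ n)
    rw [hfin]
    linarith
  obtain rfl : H = fun x => ∑' ω : L, ‖x + (ω : Euc n)‖ ^ (2 - (n : ℝ)) := funext hH
  clear hH
  refine ⟨fun x _ => summable_norm_add_rpow hp x, fun w hw x _ => ?_,
    contDiffOn_tsum_norm_rpow hp, fun x hx => ?_⟩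
  · dsimp only
    conv_rhs => rw [← (Equiv.addLeft (⟨w, hw⟩ : L)).tsum_eq]
    simp [add_assoc]
  · have h := sum_fderiv_fderiv_tsum_norm_rpow hp (EuclideanSpace.basisFun (Fin n) ℝ) hx
    simpa using h
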